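/- arXiv:1305.3355 — 2 statements merged into one kernel-verified Lean document; each statement's English description precedes it below -/
import Mathlib

section
/- Let V be a complex vector space of finite dimension n ≥ 1 and let 0 = D_0 ⊂ D_1 ⊂ ⋯ ⊂ D_n = V be a complete flag (dim D_j = j for all j). Set 𝔟 = {x ∈ End(V) : x(D_j) ⊆ D_j for all j = 0,…,n}. Then every Lie subalgebra 𝔮 of End(V) with 𝔟 ⊆ 𝔮 is the stabilizer algebra of a subflag: there exists a subset s ⊆ {0,1,…,n} with 0 ∈ s and n ∈ s such that 𝔮 = {x ∈ End(V) : x(D_j) ⊆ D_j for all j ∈ s}. -/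
open Module Submodule

attribute [local instance 100] LieRing.ofAssociativeRing

/-- A flag whose `j`-th member has dimension `j` admits an adapted basis. -/
theorem exists_basis_mem_flag_iff {K V : Type*} [Field K] [AddCommGroup V] [Module K V]
    [FiniteDimensional K V] {n : ℕ} (hdimV : finrank K V = n)
    (D : Fin (n + 1) → Submodule K V)
    (hDmono : Monotone D) (hDdim : ∀ j, finrank K (D j) = (j : ℕ)) :
    ∃ B : Basis (Fin n) K V, ∀ j v, v ∈ D j ↔ ∀ i : Fin n, j ≤ i.castSucc → B.repr v i = 0 := by
  have hex : ∀ i : Fin n, ∃ v ∈ D i.succ, v ∉ D i.castSucc := by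
    intro i
    by_contra! h
    have := Submodule.finrank_mono (show D i.succ ≤ D i.castSucc from h)
    simp [hDdim] at this
  choose e he he' using hex
  have hspan : ∀ j, D j = span K (e '' {i | i.castSucc < j}) := by
    intro j
    induction j using Fin.induction with
    | zero =>
      have h0 : D 0 = ⊥ := Submodule.finrank_eq_zero.mp (by simp [hDdim])
      simp [h0]
    | succ i ih =>
      have hset : {k : Fin n | k.castSucc < i.succ} = insert i {k | k.castSucc < i.castSucc} := by
        ext k
        simp only [Set.mem_ofPred_eq, Set.mem_insert_iff, Fin.lt_def, Fin.ext_iff, Fin.val_castSucc,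
          Fin.val_succ]
        omega
      rw [hset, Set.image_insert_eq, span_insert, ← ih]
      have hle : span K {e i} ⊔ D i.castSucc ≤ D i.succ :=
        sup_le (by simpa using he i) (hDmono (Fin.castSucc_lt_succ).le)
      have hlt : D i.castSucc < span K {e i} ⊔ D i.castSucc := by
        refine lt_of_le_of_ne le_sup_right fun h => he' i ?_
        rw [h]
        exact mem_sup_left (mem_span_singleton_self _)
      refine (Submodule.eq_of_le_of_finrank_le hle ?_).symm
      have := Submodule.finrank_lt_finrank_of_lt hlt
      simp only [hDdim, Fin.val_castSucc, Fin.val_succ] at this ⊢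
      omega
  have htop : D (Fin.last n) = ⊤ := Submodule.eq_top_of_finrank_eq (by simp [hDdim, hdimV])
  have hall : (⊤ : Submodule K V) ≤ span K (Set.range e) := by
    rw [← htop, hspan]
    exact span_mono (Set.image_subset_range _ _)
  let B := basisOfTopLeSpanOfCardEqFinrank e hall (by simp [hdimV])
  have hB : ⇑B = e := coe_basisOfTopLeSpanOfCardEqFinrank e hall (by simp [hdimV])
  refine ⟨B, fun j v => ?_⟩
  rw [hspan, ← hB, Basis.mem_span_image]
  refine forall_congr' fun i => ?_
  rw [Finset.mem_coe, Finsupp.mem_support_iff, Set.mem_ofPred_eq, ← not_le, not_imp_not]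

section ElementaryEnd

variable {K V ι : Type*} [Field K] [AddCommGroup V] [Module K V] (B : Basis ι K V)

/-- The elementary endomorphism sending the basis vector `B b` to `B a` and the others to `0`. -/
noncomputable def elementaryEnd (a b : ι) : Module.End K V := (B.coord b).smulRight (B a)

theorem elementaryEnd_apply (a b : ι) (v : V) :
    elementaryEnd B a b v = B.repr v b • B a := rfl

theorem elementaryEnd_mul_mul (x : Module.End K V) (a b c d : ι) :
    elementaryEnd B a b * x * elementaryEnd B c d =
      B.repr (x (B c)) b • elementaryEnd B a d := by
  ext v
  simp [elementaryEnd_apply, smul_smul, mul_comm]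

theorem elementaryEnd_mul_same (a b c : ι) :
    elementaryEnd B a b * elementaryEnd B b c = elementaryEnd B a c := by
  ext v
  simp [elementaryEnd_apply]

theorem elementaryEnd_mul_of_ne {b c : ι} (h : b ≠ c) (a d : ι) :
    elementaryEnd B a b * elementaryEnd B c d = 0 := by
  ext v
  simp [elementaryEnd_apply, Finsupp.single_eq_of_ne h]

theorem sum_smul_elementaryEnd [Fintype ι] (x : Module.End K V) :
    ∑ b, ∑ a, B.repr (x (B b)) a • elementaryEnd B a b = x := by
  classical
  refine B.ext fun c => ?_
  simp only [LinearMap.sum_apply, LinearMap.smul_apply, elementaryEnd_apply, Basis.repr_self,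
    Finsupp.single_apply, ite_smul, one_smul, zero_smul, smul_ite, smul_zero]
  rw [Finset.sum_eq_single c (fun b _ hb => by simp [hb.symm]) (by simp)]
  simp

variable {B} [LinearOrder ι] {Q : LieSubalgebra K (Module.End K V)}

/-- The elementary endomorphisms in a subalgebra containing the upper triangular ones
form a transitive relation. -/
theorem elementaryEnd_mem_trans (hQ : ∀ a b, a ≤ b → elementaryEnd B a b ∈ Q) {a b c : ι}
    (hab : elementaryEnd B a b ∈ Q) (hbc : elementaryEnd B b c ∈ Q) :
    elementaryEnd B a c ∈ Q := by
  by_cases h : c = a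
  · exact hQ _ _ h.ge
  · have := Q.lie_mem hab hbc
    rwa [Ring.lie_def, elementaryEnd_mul_same, elementaryEnd_mul_of_ne B h, sub_zero] at this

/-- A subalgebra containing the upper triangular elementary endomorphisms contains every
elementary endomorphism occurring with nonzero coefficient in one of its elements. -/
theorem elementaryEnd_mem_of_repr_ne_zero (hQ : ∀ a b, a ≤ b → elementaryEnd B a b ∈ Q)
    {x : Module.End K V} (hx : x ∈ Q) {a b : ι} (h : B.repr (x (B b)) a ≠ 0) :
    elementaryEnd B a b ∈ Q := by
  rcases le_or_gt a b with hab | hab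
  · exact hQ a b hab
  have key : ⁅elementaryEnd B a a, ⁅x, elementaryEnd B b b⁆⁆ =
      B.repr (x (B b)) a • elementaryEnd B a b + B.repr (x (B a)) b • elementaryEnd B b a := by
    rw [← elementaryEnd_mul_mul, ← elementaryEnd_mul_mul]
    have h1 := elementaryEnd_mul_of_ne B hab.ne' a b
    have h2 := elementaryEnd_mul_of_ne B hab.ne b a
    simp only [Ring.lie_def, mul_sub, sub_mul]
    rw [← mul_assoc (elementaryEnd B a a) (elementaryEnd B b b) x, h1, mul_assoc x, h2]
    noncomm_ring
  have hmem := Q.lie_mem (hQ a a le_rfl) (Q.lie_mem hx (hQ b b le_rfl))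
  rw [key] at hmem
  have := Q.sub_mem hmem (Q.smul_mem (B.repr (x (B a)) b) (hQ b a hab.le))
  rw [add_sub_cancel_right] at this
  simpa [smul_smul, h] using Q.smul_mem (B.repr (x (B b)) a)⁻¹ this

end ElementaryEnd

/-- Every Lie subalgebra of `End(V)` containing the stabilizer of a
complete flag is the stabilizer of a subflag. -/
theorem stmt_0 (V : Type*) [AddCommGroup V] [Module ℂ V] [FiniteDimensional ℂ V]
    (n : ℕ) (hn : 1 ≤ n) (hdimV : finrank ℂ V = n)
    (D : Fin (n + 1) → Submodule ℂ V)
    (hD0 : D 0 = ⊥) (hDtop : D (Fin.last n) = ⊤) (hDmono : Monotone D)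
    (hDdim : ∀ j, finrank ℂ (D j) = (j : ℕ))
    (Q : LieSubalgebra ℂ (Module.End ℂ V))
    (hBQ : ∀ x : Module.End ℂ V, (∀ j, (D j).map x ≤ D j) → x ∈ Q) :
    ∃ s : Set (Fin (n + 1)), (0 : Fin (n + 1)) ∈ s ∧ Fin.last n ∈ s ∧
      (Q : Set (Module.End ℂ V)) = {x | ∀ j ∈ s, (D j).map x ≤ D j} := by
  classical
  obtain ⟨B, hB⟩ := exists_basis_mem_flag_iff hdimV D hDmono hDdim
  have hBD : ∀ i j, B i ∈ D j ↔ i.castSucc < j := by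
    intro i j
    rw [hB, ← not_le]
    refine ⟨fun h hj => by simpa using h i hj, fun h k hk => ?_⟩
    rw [B.repr_self, Finsupp.single_eq_of_ne]
    rintro rfl
    exact h hk
  have hQ : ∀ a b, a ≤ b → elementaryEnd B a b ∈ Q := by
    intro a b hab
    refine hBQ _ fun j => ?_
    rw [Submodule.map_le_iff_le_comap]
    intro v hv
    rw [Submodule.mem_comap, elementaryEnd_apply]
    rcases lt_or_ge b.castSucc j with h | h
    · exact (D j).smul_mem _ ((hBD a j).2 ((Fin.castSucc_le_castSucc_iff.2 hab).trans_lt h))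
    · simp [(hB j v).1 hv b h]
  refine ⟨{j | ∀ x ∈ Q, (D j).map x ≤ D j}, by simp [hD0], by simp [hDtop],
    Set.Subset.antisymm (fun x hx j hj => hj x hx) fun x hx => ?_⟩
  rw [SetLike.mem_coe, ← sum_smul_elementaryEnd B x]
  refine sum_mem fun b _ => sum_mem fun a _ => ?_
  by_cases hab : B.repr (x (B b)) a = 0
  · simp [hab]
  refine Q.smul_mem _ ?_
  -- The indices `c` with `elementaryEnd B c b ∈ Q` form an initial segment, with maximum `m`.
  obtain ⟨m, hm, hmax⟩ := Finset.exists_max_image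
    (Finset.univ.filter fun c => elementaryEnd B c b ∈ Q) id ⟨b, by simpa using hQ b b le_rfl⟩
  simp only [Finset.mem_filter, Finset.mem_univ, true_and, id] at hm hmax
  have hseg : ∀ c, elementaryEnd B c b ∈ Q ↔ c ≤ m :=
    fun c => ⟨hmax c, fun h => elementaryEnd_mem_trans hQ (hQ c m h) hm⟩
  have hstable : ∀ y ∈ Q, (D m.succ).map y ≤ D m.succ := by
    intro y hy
    rw [Submodule.map_le_iff_le_comap]
    intro v hv
    rw [← B.sum_repr v]
    refine sum_mem fun c _ => ?_
    rcases le_or_gt c m with hc | hc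
    · refine Submodule.smul_mem _ _ ?_
      rw [Submodule.mem_comap, hB]
      intro d hd
      by_contra hne
      have := (hseg d).1 (elementaryEnd_mem_trans hQ
        (elementaryEnd_mem_of_repr_ne_zero hQ hy hne) ((hseg c).2 hc))
      exact absurd hd (not_le.2 (Fin.castSucc_lt_succ_iff.2 this))
    · rw [(hB _ v).1 hv c (Fin.succ_le_castSucc_iff.2 hc), zero_smul]
      exact zero_mem _
  have hxb : x (B b) ∈ D m.succ := hx m.succ hstable
    (Submodule.mem_map_of_mem ((hBD b _).2 (Fin.castSucc_lt_succ_iff.2 (hmax b (hQ b b le_rfl)))))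
  rw [hseg]
  by_contra h
  exact hab ((hB _ _).1 hxb a (Fin.succ_le_castSucc_iff.2 (not_le.1 h)))
end

section
/- Let n = ⌊m/2⌋ and let D_1 ⊂ D_2 ⊂ ⋯ ⊂ D_n be a chain of isotropic subspaces of V with dim D_j = j for all j (a complete isotropic flag). Set 𝔟 = {x ∈ 𝔤 : x(D_j) ⊆ D_j for all j = 1,…,n}. Then every Lie subalgebra 𝔮 of 𝔤 with 𝔟 ⊆ 𝔮 is the stabilizer of an isotropic partial flag: there exist an integer k ≥ 1 and a chain W_0 = 0 ⊆ W_1 ⊆ ⋯ ⊆ W_{k−1} of isotropic subspaces of V (possibly the trivial chain consisting only of 0) such that 𝔮 = {x ∈ 𝔤 : x(W_p) ⊆ W_p for all p = 0,…,k−1}. -/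
open Module Submodule

attribute [local instance 100] LieRing.ofAssociativeRing

namespace IsotropicFlag

variable {K V : Type*} [Field K] [AddCommGroup V] [Module K V]

section Flag

/-- The descending flag `A ⊇ S A ⊇ S (S A) ⊇ ⋯` generated by a set `S` of endomorphisms. -/
def iterImage (S : Set (End K V)) (A : Submodule K V) : ℕ → Submodule K V
  | 0 => A
  | i + 1 => ⨆ y ∈ S, (iterImage S A i).map y

variable {S : Set (End K V)} {A B : Submodule K V}

lemma iterImage_succ_le {i : ℕ} :
    iterImage S A (i + 1) ≤ B ↔ ∀ y ∈ S, ∀ v ∈ iterImage S A i, y v ∈ B := by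
  simp only [iterImage, iSup_le_iff, Submodule.map_le_iff_le_comap]
  rfl

lemma apply_mem_iterImage {i : ℕ} {y : End K V} (hy : y ∈ S) {v : V}
    (hv : v ∈ iterImage S A i) : y v ∈ iterImage S A (i + 1) :=
  iterImage_succ_le.1 le_rfl y hy v hv

lemma iterImage_mono (h : A ≤ B) (i : ℕ) : iterImage S A i ≤ iterImage S B i := by
  induction i with
  | zero => exact h
  | succ i ih => exact iterImage_succ_le.2 fun y hy v hv => apply_mem_iterImage hy (ih hv)

lemma iterImage_antitone (h : ∀ y ∈ S, ∀ v ∈ A, y v ∈ A) : Antitone (iterImage S A) := by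
  refine antitone_nat_of_succ_le fun i => ?_
  induction i with
  | zero => exact iterImage_succ_le.2 h
  | succ i ih => exact iterImage_succ_le.2 fun y hy v hv => apply_mem_iterImage hy (ih hv)

lemma iterImage_le_of_le (h : ∀ y ∈ S, ∀ v ∈ B, y v ∈ B) {i j : ℕ} (hij : i ≤ j)
    (hi : iterImage S A i ≤ B) : iterImage S A j ≤ B := by
  induction j, hij using Nat.le_induction with
  | base => exact hi
  | succ j _ ih => exact iterImage_succ_le.2 fun y hy v hv => h y hy v (ih hv)

lemma apply_mem_iterImage_of_commutator {x : End K V} (hx : ∀ y ∈ S, x * y - y * x ∈ S)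
    (hA : ∀ v ∈ A, x v ∈ A) (i : ℕ) : ∀ v ∈ iterImage S A i, x v ∈ iterImage S A i := by
  induction i with
  | zero => exact hA
  | succ i ih =>
    have : iterImage S A (i + 1) ≤ (iterImage S A (i + 1)).comap x := by
      refine iterImage_succ_le.2 fun y hy v hv => ?_
      have h : x (y v) = y (x v) + (x * y - y * x) v := by simp
      rw [Submodule.mem_comap, h]
      exact add_mem (apply_mem_iterImage hy (ih v hv)) (apply_mem_iterImage (hx y hy) hv)
    exact this

end Flag

variable {ω : LinearMap.BilinForm K V} {ε : K}

/-- `T` moves every step of the flag `E 0 ⊆ ⋯ ⊆ E n ⊆ (E n)ᗮ ⊆ ⋯ ⊆ (E 0)ᗮ` into the preceding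
one. -/
structure Lowers (ω : LinearMap.BilinForm K V) (E : ℕ → Submodule K V) (n : ℕ) (T : End K V) :
    Prop where
  lower : ∀ j < n, ∀ v ∈ E (j + 1), T v ∈ E j
  middle : ∀ v ∈ ω.orthogonal (E n), T v ∈ E n
  upper : ∀ j < n, ∀ v ∈ ω.orthogonal (E j), T v ∈ ω.orthogonal (E (j + 1))

section Lowers

variable {E : ℕ → Submodule K V} {n : ℕ}

lemma iterImage_eq_bot_of_lowers {S : Set (End K V)} (h0 : E 0 = ⊥)
    (hS : ∀ T ∈ S, Lowers ω E n T) : iterImage S ⊤ (2 * n + 1) = ⊥ := by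
  have hup : ∀ i ≤ n, iterImage S ⊤ i ≤ ω.orthogonal (E i) := by
    intro i
    induction i with
    | zero => simp [h0]
    | succ i ih =>
      exact fun hi => iterImage_succ_le.2 fun y hy v hv =>
        (hS y hy).upper i hi v (ih (by lia) hv)
  have hlow : ∀ i ≤ n, iterImage S ⊤ (n + 1 + i) ≤ E (n - i) := by
    intro i
    induction i with
    | zero =>
      exact fun _ => iterImage_succ_le.2 fun y hy v hv => (hS y hy).middle v (hup n le_rfl hv)
    | succ i ih =>
      refine fun hi => iterImage_succ_le.2 fun y hy v hv => ?_
      refine (hS y hy).lower _ (by lia) v ?_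
      have := ih (by lia) hv
      rwa [show n - i = n - (i + 1) + 1 by lia] at this
  have h := hlow n le_rfl
  rw [Nat.sub_self, h0, le_bot_iff] at h
  rwa [show 2 * n + 1 = n + 1 + n by lia]

lemma Lowers.isNilpotent {T : End K V} (h0 : E 0 = ⊥) (hT : Lowers ω E n T) :
    IsNilpotent T := by
  refine ⟨2 * n + 1, LinearMap.ext fun v => ?_⟩
  have hpow : ∀ i, (T ^ i) v ∈ iterImage {T} ⊤ i := by
    intro i
    induction i with
    | zero => exact Submodule.mem_top
    | succ i ih =>
      rw [pow_succ', Module.End.mul_apply]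
      exact apply_mem_iterImage (Set.mem_singleton T) ih
  have := hpow (2 * n + 1)
  rwa [iterImage_eq_bot_of_lowers h0 (fun _ h => (Set.mem_singleton_iff.1 h).symm ▸ hT), Submodule.mem_bot] at this

end Lowers

/-- The space of endomorphisms that are skew-adjoint with respect to `ω`. -/
def skew (ω : LinearMap.BilinForm K V) : Submodule K (End K V) where
  carrier := {x | ∀ v w, ω (x v) w = -ω v (x w)}
  zero_mem' := by simp
  add_mem' := by
    intro x y hx hy v w
    simp [hx v w, hy v w]
    ring
  smul_mem' := by
    intro c x hx v w
    simp [hx v w]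

lemma apply_mem_orthogonal {x : End K V} (hx : x ∈ skew ω) {A B : Submodule K V}
    (h : ∀ a ∈ A, x a ∈ B) {v : V} (hv : v ∈ ω.orthogonal B) : x v ∈ ω.orthogonal A := by
  intro a ha
  have h1 : ω (x a) v = 0 := hv _ (h a ha)
  have h2 := hx a v
  rw [h1, eq_comm, neg_eq_zero] at h2
  exact h2

/-- The skew-adjoint endomorphism `v ↦ ω(b, v) a - ε ω(a, v) b`. -/
def rankTwo (ω : LinearMap.BilinForm K V) (ε : K) (a b : V) : End K V :=
  (ω b).smulRight a - ε • (ω a).smulRight b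

lemma rankTwo_apply (a b v : V) :
    rankTwo ω ε a b v = ω b v • a - ε • ω a v • b := rfl

section Form

variable (hε : ε * ε = 1) (hω : ∀ v w, ω v w = ε * ω w v)
include hε hω

lemma rankTwo_mem_skew (a b : V) : rankTwo ω ε a b ∈ skew ω := by
  intro v w
  simp only [rankTwo_apply, map_sub, map_smul, LinearMap.sub_apply, LinearMap.smul_apply,
    smul_eq_mul]
  rw [hω v a, hω v b]
  linear_combination (-ω b v * ω a w) * hε

lemma trace_rankTwo_mul [FiniteDimensional K V] {y : End K V} (hy : y ∈ skew ω) (a b : V) :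
    LinearMap.trace K V (rankTwo ω ε a b * y) = 2 * ω b (y a) := by
  have h : rankTwo ω ε a b * y =
      ((ω b).comp y).smulRight a - ε • ((ω a).comp y).smulRight b := rfl
  have h1 := hy a b
  rw [hω (y a) b] at h1
  rw [h, map_sub, map_smul, LinearMap.trace_smulRight, LinearMap.trace_smulRight,
    LinearMap.comp_apply, LinearMap.comp_apply, smul_eq_mul]
  linear_combination (-ε) * h1 + ω b (y a) * hε

omit hε in
lemma isRefl_of_eq_mul : ω.IsRefl := fun v w h => by rw [hω w v, h, mul_zero]

end Form

/-- The trace form on the space of skew-adjoint endomorphisms. -/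
noncomputable def skewTraceForm (ω : LinearMap.BilinForm K V) : LinearMap.BilinForm K (skew ω) :=
  ((LinearMap.mul K (End K V)).compr₂ (LinearMap.trace K V)).compl₁₂ (skew ω).subtype
    (skew ω).subtype

lemma skewTraceForm_apply (x y : skew ω) :
    skewTraceForm ω x y = LinearMap.trace K V ((x : End K V) * y) := rfl

lemma skewTraceForm_isRefl : (skewTraceForm ω).IsRefl := fun x y h => by
  rw [skewTraceForm_apply] at h ⊢
  rwa [LinearMap.trace_mul_comm]

/-- The skew-adjoint endomorphisms that are orthogonal to `Q` for the trace form. -/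
def traceOrthogonal (ω : LinearMap.BilinForm K V) (Q : Submodule K (End K V)) :
    Set (End K V) :=
  {y | y ∈ skew ω ∧ ∀ x ∈ Q, LinearMap.trace K V (x * y) = 0}

section Parabolic

variable [FiniteDimensional K V] [NeZero (2 : K)] (hε : ε * ε = 1)
  (hω : ∀ v w, ω v w = ε * ω w v) (hnd : ω.Nondegenerate)
include hε hω hnd

lemma skewTraceForm_nondegenerate : (skewTraceForm ω).Nondegenerate := by
  refine (LinearMap.IsRefl.nondegenerate_iff_separatingRight (B := skewTraceForm ω)
    skewTraceForm_isRefl).2 ?_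
  intro y hy
  ext a
  refine hnd.2 _ fun b => ?_
  have h := hy ⟨_, rankTwo_mem_skew hε hω a b⟩
  rw [skewTraceForm_apply, trace_rankTwo_mul hε hω y.2] at h
  exact (mul_eq_zero.1 h).resolve_left two_ne_zero

lemma mem_of_trace_mul_eq_zero {Q : Submodule K (End K V)} (hQ : Q ≤ skew ω) {x : End K V}
    (hx : x ∈ skew ω) (h : ∀ y ∈ traceOrthogonal ω Q, LinearMap.trace K V (x * y) = 0) :
    x ∈ Q := by
  have key := LinearMap.BilinForm.orthogonal_orthogonal
    (skewTraceForm_nondegenerate hε hω hnd) skewTraceForm_isRefl (Q.comap (skew ω).subtype)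
  suffices hmem : (⟨x, hx⟩ : skew ω) ∈ Q.comap (skew ω).subtype from hmem
  rw [← key]
  intro y hy
  change skewTraceForm ω y ⟨x, hx⟩ = 0
  rw [skewTraceForm_apply, LinearMap.trace_mul_comm]
  exact h y ⟨y.2, fun z hz => hy ⟨z, hQ hz⟩ hz⟩

variable {E : ℕ → Submodule K V} {n : ℕ} (hE0 : E 0 = ⊥) (hE : Monotone E)
  (hEn : ∀ j, E j ≤ E n) (hEiso : E n ≤ ω.orthogonal (E n))
  {Q : Submodule K (End K V)} (hQ : Q ≤ skew ω)
  (hEQ : ∀ x ∈ skew ω, (∀ j, ∀ v ∈ E j, x v ∈ E j) → x ∈ Q)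

section Nilradical

include hE hEn hEiso hEQ

/-- The trace-orthogonal of a subspace containing the stabilizer of an isotropic flag lowers
that flag. -/
lemma lowers_of_mem_traceOrthogonal {y : End K V} (hy : y ∈ traceOrthogonal ω Q) :
    Lowers ω E n y := by
  have hrefl : ω.IsRefl := isRefl_of_eq_mul hω
  have hzero : ∀ a b, (∀ j, ∀ v ∈ E j, rankTwo ω ε a b v ∈ E j) → ω b (y a) = 0 := by
    intro a b hab
    have h := hy.2 _ (hEQ _ (rankTwo_mem_skew hε hω a b) hab)
    rw [trace_rankTwo_mul hε hω hy.1] at h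
    exact (mul_eq_zero.1 h).resolve_left two_ne_zero
  have hlow : ∀ j < n, ∀ v ∈ E (j + 1), y v ∈ E j := by
    intro j hj a ha
    rw [← LinearMap.BilinForm.orthogonal_orthogonal hnd hrefl (E j)]
    intro b hb
    refine hzero a b fun i v hv => ?_
    have hav : ω a v = 0 := hEiso (hEn _ hv) a (hEn _ ha)
    rw [rankTwo_apply, hav, zero_smul, smul_zero, sub_zero]
    rcases le_or_gt i j with hij | hij
    · rw [hrefl v b (hb v (hE hij hv)), zero_smul]
      exact zero_mem _
    · exact smul_mem _ _ (hE hij ha)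
  refine ⟨hlow, fun a ha => ?_, fun j hj v hv => apply_mem_orthogonal hy.1 (hlow j hj) hv⟩
  rw [← LinearMap.BilinForm.orthogonal_orthogonal hnd hrefl (E n)]
  intro b hb
  refine hzero a b fun i v hv => ?_
  have hv' := hEn _ hv
  rw [rankTwo_apply, hrefl v b (hb v hv'), hrefl v a (ha v hv')]
  simp

include hE0 in
lemma mem_of_mem_traceOrthogonal {y : End K V} (hy : y ∈ traceOrthogonal ω Q) : y ∈ Q := by
  have hlow := (lowers_of_mem_traceOrthogonal hε hω hnd hE hEn hEiso hEQ hy).lower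
  have hstab : ∀ j ≤ n, ∀ v ∈ E j, y v ∈ E j := by
    rintro (_ | j) hj v hv
    · rw [hE0, Submodule.mem_bot] at hv ⊢
      rw [hv, map_zero]
    · exact hE j.le_succ (hlow j hj v hv)
  refine hEQ y hy.1 fun j v hv => ?_
  rcases le_total j n with hj | hj
  · exact hstab j hj v hv
  · exact hE hj (hstab n le_rfl v (hEn j hv))

end Nilradical

omit [FiniteDimensional K V] [NeZero (2 : K)] hε hω hnd in
lemma commutator_mem_traceOrthogonal (hQ : Q ≤ skew ω)
    (hQlie : ∀ x ∈ Q, ∀ y ∈ Q, x * y - y * x ∈ Q) {x y : End K V} (hx : x ∈ Q)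
    (hy : y ∈ traceOrthogonal ω Q) : x * y - y * x ∈ traceOrthogonal ω Q := by
  refine ⟨fun v w => ?_, fun z hz => ?_⟩
  · have hx' := hQ hx
    simp only [LinearMap.sub_apply, Module.End.mul_apply, map_sub]
    rw [hx' (y v) w, hy.1 (x v) w, hy.1 v (x w), hx' v (y w)]
    ring
  · have h := hy.2 _ (hQlie z hz x hx)
    rw [sub_mul, map_sub] at h
    rw [mul_sub, map_sub, ← mul_assoc, ← mul_assoc, LinearMap.trace_mul_comm K (z * y) x,
      ← mul_assoc]
    exact h

omit [FiniteDimensional K V] [NeZero (2 : K)] hε hnd in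
/-- If `W` is a maximal isotropic `Q`-stable subspace, a nilpotent ideal `N` of `Q` maps
the orthogonal of `W` into `W`. -/
lemma apply_mem_of_maximal (hQ : Q ≤ skew ω) {N : Set (End K V)} (hNQ : N ⊆ Q)
    (hN : ∀ x ∈ Q, ∀ y ∈ N, x * y - y * x ∈ N) {L : ℕ} (hL : iterImage N ⊤ L = ⊥)
    {W : Submodule K V} (hW : Maximal
      (fun U => (∀ x ∈ Q, ∀ v ∈ U, x v ∈ U) ∧ U ≤ ω.orthogonal U) W)
    {y : End K V} (hy : y ∈ N) {v : V} (hv : v ∈ ω.orthogonal W) : y v ∈ W := by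
  classical
  set A := ω.orthogonal W
  have hrefl : ω.IsRefl := isRefl_of_eq_mul hω
  have hAQ : ∀ x ∈ Q, ∀ v ∈ A, x v ∈ A := fun x hx v hv =>
    apply_mem_orthogonal (hQ hx) (hW.prop.1 x hx) hv
  have hex : ∃ i, iterImage N A i ≤ W :=
    ⟨L, (iterImage_mono le_top L).trans (hL.le.trans bot_le)⟩
  obtain ⟨i, hi, hmin⟩ : ∃ i, iterImage N A i ≤ W ∧ ∀ j < i, ¬ iterImage N A j ≤ W :=
    ⟨Nat.find hex, Nat.find_spec hex, fun j hj => Nat.find_min hex hj⟩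
  have hWN : ∀ y ∈ N, ∀ v ∈ W, y v ∈ W := fun y hy => hW.prop.1 y (hNQ hy)
  rcases le_or_gt i 1 with hi1 | hi1
  · exact iterImage_le_of_le hWN hi1 hi (apply_mem_iterImage hy hv)
  obtain ⟨k, rfl⟩ : ∃ k, i = k + 1 := ⟨i - 1, by lia⟩
  set H := iterImage N A k
  have hHA : H ≤ A := iterImage_antitone (fun y hy => hAQ y (hNQ hy)) k.zero_le
  have hpair : ∀ p q, k + 1 ≤ p + q →
      ∀ b ∈ iterImage N A q, iterImage N A p ≤ LinearMap.ker (ω.flip b) := by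
    intro p
    induction p with
    | zero =>
      intro q hq b hb a ha
      have hbW : b ∈ W := iterImage_le_of_le hWN (by lia) hi hb
      exact hrefl _ _ (ha b hbW)
    | succ p ih =>
      intro q hq b hb
      refine iterImage_succ_le.2 fun y hy a ha => ?_
      have h : ω a (y b) = 0 := ih (q + 1) (by lia) (y b) (apply_mem_iterImage hy hb) ha
      change ω (y a) b = 0
      rw [hQ (hNQ hy) a b, h, neg_zero]
  have hHH : H ≤ ω.orthogonal H := fun b hb a ha => hpair k k (by lia) b hb ha
  have hWH : W ≤ ω.orthogonal H := fun b hb a ha => hrefl _ _ (hHA ha b hb)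
  have hle : H ⊔ W ≤ W := hW.le_of_ge ⟨fun x hx => ?_, ?_⟩ le_sup_right
  · exact absurd (le_sup_left.trans hle) (hmin k k.lt_succ_self)
  · have : H ⊔ W ≤ (H ⊔ W).comap x := sup_le
      (fun v hv => mem_sup_left
        (apply_mem_iterImage_of_commutator (hN x hx) (hAQ x hx) k v hv))
      (fun v hv => mem_sup_right (hW.prop.1 x hx v hv))
    exact this
  · intro b hb a ha
    obtain ⟨a₁, ha₁, a₂, ha₂, rfl⟩ := Submodule.mem_sup.1 ha
    obtain ⟨b₁, hb₁, b₂, hb₂, rfl⟩ := Submodule.mem_sup.1 hb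
    have h1 : ω a₁ b₁ = 0 := hHH hb₁ a₁ ha₁
    have h2 : ω a₁ b₂ = 0 := hWH hb₂ a₁ ha₁
    have h3 : ω a₂ b₁ = 0 := hHA hb₁ a₂ ha₂
    have h4 : ω a₂ b₂ = 0 := hW.prop.2 hb₂ a₂ ha₂
    change ω (a₁ + a₂) (b₁ + b₂) = 0
    simp [h1, h2, h3, h4]

include hE0 hE hEn hEiso hQ hEQ

/-- A Lie algebra of skew-adjoint endomorphisms containing the stabilizer of an isotropic flag
is the stabilizer of an isotropic flag. -/
theorem exists_isotropic_flag (hQlie : ∀ x ∈ Q, ∀ y ∈ Q, x * y - y * x ∈ Q) :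
    ∃ (L : ℕ) (W : ℕ → Submodule K V), W 0 = ⊥ ∧ Monotone W ∧
      (∀ p, W p ≤ ω.orthogonal (W p)) ∧
      ∀ x, x ∈ Q ↔ x ∈ skew ω ∧ ∀ p ≤ L, ∀ v ∈ W p, x v ∈ W p := by
  set N := traceOrthogonal ω Q
  have hNQ : N ⊆ Q := fun y hy =>
    mem_of_mem_traceOrthogonal hε hω hnd hE0 hE hEn hEiso hEQ hy
  have hN : ∀ x ∈ Q, ∀ y ∈ N, x * y - y * x ∈ N := fun x hx y hy =>
    commutator_mem_traceOrthogonal hQ hQlie hx hy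
  obtain ⟨L, hL⟩ : ∃ L, iterImage N ⊤ L = ⊥ := ⟨_, iterImage_eq_bot_of_lowers hE0 fun y hy =>
    lowers_of_mem_traceOrthogonal hε hω hnd hE hEn hEiso hEQ hy⟩
  obtain ⟨M, hM⟩ : ∃ M, Maximal
      (fun U : Submodule K V => (∀ x ∈ Q, ∀ v ∈ U, x v ∈ U) ∧ U ≤ ω.orthogonal U) M :=
    exists_maximal_of_wellFoundedGT _ ⟨⊥, by simp, bot_le⟩
  set F := iterImage N ⊤
  have hF : Antitone F := iterImage_antitone fun _ _ _ _ => Submodule.mem_top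
  set W : ℕ → Submodule K V := fun p => M ⊓ F (L - p) with hWdef
  have hW0 : W 0 = ⊥ := by simp [hWdef, F, hL]
  have hWL : W L = M := by simp [hWdef, F, iterImage]
  refine ⟨L, W, hW0, fun p q hpq => inf_le_inf_left _ (hF (by lia)), fun p v hv w hw =>
    hM.prop.2 hv.1 w hw.1, fun x => ⟨fun hx => ⟨hQ hx, fun p _ v hv =>
      ⟨hM.prop.1 x hx v hv.1, ?_⟩⟩, fun ⟨hxs, hx⟩ => ?_⟩⟩
  · exact apply_mem_iterImage_of_commutator (hN x hx) (fun _ _ => Submodule.mem_top) _ v hv.2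
  refine mem_of_trace_mul_eq_zero hε hω hnd hQ hxs fun y hy => ?_
  have hlow : ∀ j < L, ∀ v ∈ W (j + 1), y v ∈ W j := by
    refine fun j hj v hv => ⟨hM.prop.1 y (hNQ hy) v hv.1, ?_⟩
    rw [show L - j = L - (j + 1) + 1 by lia]
    exact apply_mem_iterImage hy hv.2
  have hT : Lowers ω W L (x * y) := by
    refine ⟨fun j hj v hv => hx j hj.le _ (hlow j hj v hv), fun v hv => hx L le_rfl _ ?_,
      fun j hj v hv => apply_mem_orthogonal hxs (hx (j + 1) hj)
        (apply_mem_orthogonal hy.1 (hlow j hj) hv)⟩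
    rw [hWL] at hv ⊢
    exact apply_mem_of_maximal hω hQ hNQ hN hL hM hy hv
  exact (LinearMap.isNilpotent_trace_of_isNilpotent (hT.isNilpotent hW0)).eq_zero

end Parabolic

end IsotropicFlag

/-- Every Lie subalgebra of `𝔤` (the Lie algebra of endomorphisms
skew-adjoint with respect to a nondegenerate symmetric or alternating form `ω`) containing
the stabilizer in `𝔤` of a complete isotropic flag is the stabilizer in `𝔤` of an
isotropic partial flag. -/
theorem stmt_2 (V : Type*) [AddCommGroup V] [Module ℂ V] [FiniteDimensional ℂ V]
    (m n : ℕ) (hdimV : finrank ℂ V = m) (hn : n = m / 2)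
    (ω : V →ₗ[ℂ] V →ₗ[ℂ] ℂ)
    (hnd : ∀ v, (∀ w, ω v w = 0) → v = 0)
    (hso : (∀ v w, ω v w = ω w v) ∨ (∀ v, ω v v = 0))
    (D : Fin n → Submodule ℂ V) (hDmono : Monotone D)
    (hDdim : ∀ j, finrank ℂ (D j) = (j : ℕ) + 1)
    (hDiso : ∀ j, ∀ v ∈ D j, ∀ w ∈ D j, ω v w = 0)
    (Q : LieSubalgebra ℂ (Module.End ℂ V))
    (hQg : ∀ x ∈ Q, ∀ v w, ω (x v) w = - ω v (x w))
    (hBQ : ∀ x : Module.End ℂ V, (∀ v w, ω (x v) w = - ω v (x w)) →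
      (∀ j, (D j).map x ≤ D j) → x ∈ Q) :
    ∃ (k : ℕ) (hk : 1 ≤ k) (W : Fin k → Submodule ℂ V),
      W ⟨0, hk⟩ = ⊥ ∧ Monotone W ∧
      (∀ p, ∀ v ∈ W p, ∀ w ∈ W p, ω v w = 0) ∧
      (Q : Set (Module.End ℂ V)) =
        {x | (∀ v w, ω (x v) w = - ω v (x w)) ∧ ∀ p, (W p).map x ≤ W p} := by
  have hform : ∃ ε : ℂ, ε * ε = 1 ∧ ∀ v w, ω v w = ε * ω w v := by
    rcases hso with h | h
    · exact ⟨1, by ring, fun v w => by rw [h v w, one_mul]⟩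
    · refine ⟨-1, by ring, fun v w => ?_⟩
      have h1 := h (v + w)
      simp only [map_add, LinearMap.add_apply, h v, h w] at h1
      linear_combination h1
  obtain ⟨ε, hε, hω⟩ := hform
  have hrefl : LinearMap.BilinForm.IsRefl ω := IsotropicFlag.isRefl_of_eq_mul hω
  have hnd' : LinearMap.BilinForm.Nondegenerate ω :=
    (LinearMap.IsRefl.nondegenerate_iff_separatingLeft hrefl).2 hnd
  let E : ℕ → Submodule ℂ V := fun j => ⨆ i : Fin n, ⨆ _ : (i : ℕ) < j, D i
  have hEmono : Monotone E := fun a b hab =>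
    iSup_mono fun i => iSup_mono' fun h => ⟨h.trans_le hab, le_rfl⟩
  have hEsucc : ∀ j : Fin n, E (j + 1) = D j := fun j => le_antisymm
    (iSup₂_le fun i hi => hDmono (Nat.lt_succ_iff.1 hi)) (le_iSup₂_of_le j j.1.lt_succ_self le_rfl)
  have hE0 : E 0 = ⊥ := by simp [E]
  have hEn : ∀ j, E j ≤ E n := fun j => iSup₂_le fun i _ => le_iSup₂_of_le i i.2 le_rfl
  have hEiso : E n ≤ LinearMap.BilinForm.orthogonal ω (E n) := by
    rcases n with _ | n
    · simp [hE0]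
    · intro v hv w hw
      rw [show E (n + 1) = D (Fin.last n) from hEsucc (Fin.last n)] at hv hw
      exact hDiso _ w hw v hv
  obtain ⟨L, W, hW0, hWmono, hWiso, hWQ⟩ := IsotropicFlag.exists_isotropic_flag hε hω hnd' hE0
    hEmono hEn hEiso (Q := Q.toSubmodule) hQg
    (fun x hx h => hBQ x hx fun j => Submodule.map_le_iff_le_comap.2 fun v hv => by
      rw [← hEsucc] at hv ⊢
      exact h _ v hv)
    (fun x hx y hy => Q.lie_mem hx hy)
  refine ⟨L + 1, by lia, fun p => W p, hW0, fun p q hpq => hWmono hpq,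
    fun p v hv w hw => hWiso p hw v hv, Set.ext fun x => (hWQ x).trans (and_congr Iff.rfl ?_)⟩
  refine ⟨fun h p => Submodule.map_le_iff_le_comap.2 (h p (Nat.lt_succ_iff.1 p.2)),
    fun h p hp => Submodule.map_le_iff_le_comap.1 (h ⟨p, Nat.lt_succ_iff.2 hp⟩)⟩
end
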